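/- arXiv:1506.05098 — 2 statements merged into one kernel-verified Lean document; each statement's English description precedes it below -/
import Mathlib

section
/- Let ν₁ and ν₂ be probability measures on ℝ, let m_{ν₁} and m_{ν₁−ν₂} denote the Stieltjes transforms of ν₁ and of the signed measure ν₁ − ν₂, and let η₁, η₂, ε ∈ (0,1] with ε ≥ max{η₁, η₂} and τ₁ < τ₂. Then there is a universal constant C > 0 such that |ν₁([τ₁,τ₂]) − ν₂([τ₁,τ₂])| ≤ C (ν₁([τ₁−η₁, τ₁]) + ν₁([τ₂, τ₂+η₂]) + J₁ + J₂ + J₃), where J₁ = ∫_{τ₁−η₁}^{τ₁} (Im m_{ν₁}(ω+iη₁) + |m_{ν₁−ν₂}(ω+iη₁)| + η₁^{-1} ∫_{η₁}^{2ε} |m_{ν₁−ν₂}(ω+iη)| dη) dω, J₂ is the analogous integral over [τ₂, τ₂+η₂] with η₂, and J₃ = ε^{-1} ∫_{τ₁−η₁}^{τ₂+η₂} ∫_ε^{2ε} |m_{ν₁−ν₂}(ω+iη)| dη dω. -/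
open MeasureTheory Complex

/-- Adding the conjugate Poisson kernel to `arctan` approximates `π / 2 * sign` up to an error of
the size of the Poisson kernel. -/
theorem abs_arctan_add_conjPoisson_sub_sign_le (s : ℝ) :
    |Real.arctan s + s / (1 + s ^ 2) - Real.pi / 2 * SignType.sign s| ≤ 8 / (1 + s ^ 2) := by
  wlog hs : 0 ≤ s generalizing s
  · have h := this (-s) (by linarith)
    rw [Real.arctan_neg, Left.sign_neg, neg_sq, ← abs_neg] at h
    convert h using 2
    push_cast
    ring
  rcases hs.eq_or_lt with rfl | hs
  · simp
  rw [sign_pos hs, SignType.coe_one, mul_one]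
  have hpos : 0 < 1 + s ^ 2 := by positivity
  rcases lt_or_ge s 1 with h1 | h1
  · have h0 : 0 < Real.arctan s := Real.arctan_pos.2 hs
    have h2 : s / (1 + s ^ 2) ≤ 1 := by
      rw [div_le_one hpos]; nlinarith
    have h3 : 0 ≤ s / (1 + s ^ 2) := by positivity
    have h4 : 4 ≤ 8 / (1 + s ^ 2) := by
      rw [le_div_iff₀ hpos]; nlinarith
    have h5 := Real.arctan_lt_pi_div_two s
    have h6 := Real.pi_le_four
    rw [abs_le]
    constructor <;> linarith
  · set y := Real.arctan s⁻¹ with hy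
    have hys : Real.arctan s = Real.pi / 2 - y := by
      rw [hy, Real.arctan_inv_of_pos hs]; ring
    have hy0 : 0 < y := Real.arctan_pos.2 (inv_pos.2 hs)
    have hupper : y ≤ s⁻¹ := by
      have := Real.le_tan hy0.le (Real.arctan_lt_pi_div_two _)
      rwa [hy, Real.tan_arctan] at this
    have h2 : s⁻¹ - s / (1 + s ^ 2) ≤ 8 / (1 + s ^ 2) := by
      have : s⁻¹ - s / (1 + s ^ 2) = s⁻¹ / (1 + s ^ 2) := by field_simp; ring
      rw [this]
      gcongr
      linarith [inv_le_one_of_one_le₀ h1]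
    have hlower : s / (1 + s ^ 2) ≤ y := by
      have h3 : Real.sin (2 * y) ≤ 2 * y := Real.sin_le (by linarith)
      have h4 : Real.sin (2 * y) = 2 * (s / (1 + s ^ 2)) := by
        rw [Real.sin_two_mul, hy, ← Real.tan_mul_cos (Real.cos_arctan_pos _).ne', mul_assoc 2,
          mul_assoc, ← sq, Real.cos_sq_arctan, Real.tan_arctan]
        field_simp
        ring
      linarith
    have h7 : 0 ≤ 8 / (1 + s ^ 2) := by positivity
    rw [hys, abs_le]
    constructor <;> linarith

theorem abs_arctan_div_add_conjPoisson_sub_sign_le {η : ℝ} (hη : 0 < η) (t : ℝ) :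
    |Real.arctan (t / η) + η * (t / (t ^ 2 + η ^ 2)) - Real.pi / 2 * SignType.sign t| ≤
      8 * (η * (η / (t ^ 2 + η ^ 2))) := by
  have h := abs_arctan_add_conjPoisson_sub_sign_le (t / η)
  have h1 : SignType.sign (t / η) = SignType.sign t := by
    rw [div_eq_mul_inv, sign_mul, sign_pos (inv_pos.2 hη), mul_one]
  have h2 : t / η / (1 + (t / η) ^ 2) = η * (t / (t ^ 2 + η ^ 2)) := by
    have : 0 < t ^ 2 + η ^ 2 := by positivity
    field_simp
    ring
  have h3 : 8 / (1 + (t / η) ^ 2) = 8 * (η * (η / (t ^ 2 + η ^ 2))) := by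
    have : 0 < t ^ 2 + η ^ 2 := by positivity
    field_simp
    ring
  rwa [h1, h2, h3] at h

theorem one_le_two_mul_poisson {η t : ℝ} (hη : 0 < η) (ht : |t| ≤ η) :
    1 ≤ 2 * (η * (η / (t ^ 2 + η ^ 2))) := by
  have h : t ^ 2 ≤ η ^ 2 := sq_le_sq.2 (by rwa [abs_of_pos hη])
  have : 0 < t ^ 2 + η ^ 2 := by positivity
  rw [show 2 * (η * (η / (t ^ 2 + η ^ 2))) = 2 * η ^ 2 / (t ^ 2 + η ^ 2) by ring,
    le_div_iff₀ this]
  linarith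

theorem abs_indicator_Icc_sub_sign_le {η₁ η₂ τ₁ τ₂ a b : ℝ} (h₁ : 0 < η₁) (h₂ : 0 < η₂)
    (hτ : τ₁ < τ₂) (ha : a ∈ Set.Icc (τ₁ - η₁) τ₁) (hb : b ∈ Set.Icc τ₂ (τ₂ + η₂)) (τ : ℝ) :
    |Real.pi * (Set.Icc τ₁ τ₂).indicator 1 τ -
        (Real.pi / 2 * SignType.sign (τ - a) - Real.pi / 2 * SignType.sign (τ - b))| ≤
      7 * (η₁ * (η₁ / ((τ - a) ^ 2 + η₁ ^ 2))) + 7 * (η₂ * (η₂ / ((τ - b) ^ 2 + η₂ ^ 2))) := by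
  obtain ⟨ha1, ha2⟩ := ha
  obtain ⟨hb1, hb2⟩ := hb
  have hpi := Real.pi_pos
  have hpi' : Real.pi < 3.15 := Real.pi_lt_d2
  have hA : 0 ≤ η₁ * (η₁ / ((τ - a) ^ 2 + η₁ ^ 2)) := by positivity
  have hB : 0 ≤ η₂ * (η₂ / ((τ - b) ^ 2 + η₂ ^ 2)) := by positivity
  by_cases hI : τ ∈ Set.Icc (τ₁ - η₁) τ₁ ∪ Set.Icc τ₂ (τ₂ + η₂)
  · have hone : 1 ≤ 2 * (η₁ * (η₁ / ((τ - a) ^ 2 + η₁ ^ 2))) +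
        2 * (η₂ * (η₂ / ((τ - b) ^ 2 + η₂ ^ 2))) := by
      rcases hI with ⟨h3, h4⟩ | ⟨h3, h4⟩
      · have := one_le_two_mul_poisson (t := τ - a) h₁ (abs_le.2 ⟨by linarith, by linarith⟩)
        linarith
      · have := one_le_two_mul_poisson (t := τ - b) h₂ (abs_le.2 ⟨by linarith, by linarith⟩)
        linarith
    refine le_trans (b := Real.pi) ?_ (by linarith)
    have hsign : 0 ≤ Real.pi / 2 * (SignType.sign (τ - a) : ℝ) -
        Real.pi / 2 * SignType.sign (τ - b) ∧ Real.pi / 2 * (SignType.sign (τ - a) : ℝ) -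
        Real.pi / 2 * SignType.sign (τ - b) ≤ Real.pi := by
      rcases lt_trichotomy (τ - a) 0 with h | h | h <;>
        rcases lt_trichotomy (τ - b) 0 with h' | h' | h' <;>
        simp only [h, h', sign_pos, sign_neg, sign_zero, SignType.coe_one, SignType.coe_zero,
          SignType.coe_neg_one] <;> constructor <;> linarith
    have hind : (Set.Icc τ₁ τ₂).indicator (1 : ℝ → ℝ) τ = 0 ∨
        (Set.Icc τ₁ τ₂).indicator (1 : ℝ → ℝ) τ = 1 := Set.indicator_eq_zero_or_self _ _ _
    rw [abs_le]
    rcases hind with h | h <;> rw [h] <;> constructor <;> linarith [hsign.1, hsign.2]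
  · simp only [Set.mem_union, Set.mem_Icc, not_or, not_and_or, not_le] at hI
    refine le_trans (b := 0) ?_ (by positivity)
    rw [abs_nonpos_iff]
    obtain ⟨h3, h4⟩ := hI
    rcases h3 with h3 | h3
    · rw [Set.indicator_of_notMem (by simp only [Set.mem_Icc]; intro h; linarith [h.1, h.2]),
        sign_neg (by linarith), sign_neg (by linarith)]
      simp
    · rcases h4 with h4 | h4
      · rw [Set.indicator_of_mem (show τ ∈ Set.Icc τ₁ τ₂ from ⟨h3.le, h4.le⟩),
          sign_pos (by linarith), sign_neg (by linarith)]
        simp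
      · rw [Set.indicator_of_notMem (by simp only [Set.mem_Icc]; intro h; linarith [h.1, h.2]),
          sign_pos (by linarith), sign_pos (by linarith)]
        simp

/-- The Cauchy kernel. -/
noncomputable def cauchyKernel (ω η τ : ℝ) : ℂ := ((τ : ℂ) - (ω + η * I))⁻¹

/-- The Stieltjes transform of `ν` at `ω + i η`. -/
noncomputable def stieltjes (ν : Measure ℝ) (ω η : ℝ) : ℂ := ∫ τ : ℝ, cauchyKernel ω η τ ∂ν

theorem cauchyKernel_re (ω η τ : ℝ) :
    (cauchyKernel ω η τ).re = (τ - ω) / ((τ - ω) ^ 2 + η ^ 2) := by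
  simp [cauchyKernel, inv_re, normSq_apply, sq]

theorem cauchyKernel_im (ω η τ : ℝ) :
    (cauchyKernel ω η τ).im = η / ((τ - ω) ^ 2 + η ^ 2) := by
  simp [cauchyKernel, inv_im, normSq_apply, sq]

theorem norm_cauchyKernel_le {η : ℝ} (hη : 0 < η) (ω τ : ℝ) : ‖cauchyKernel ω η τ‖ ≤ η⁻¹ := by
  rw [cauchyKernel, norm_inv]
  gcongr
  have h := abs_im_le_norm ((τ : ℂ) - (ω + η * I))
  simpa [abs_of_pos hη] using h

theorem measurable_cauchyKernel :
    Measurable fun p : (ℝ × ℝ) × ℝ => cauchyKernel p.1.1 p.1.2 p.2 := by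
  unfold cauchyKernel
  fun_prop

theorem integrable_cauchyKernel (ν : Measure ℝ) [IsFiniteMeasure ν] {η : ℝ} (hη : 0 < η) (ω : ℝ) :
    Integrable (cauchyKernel ω η) ν :=
  Integrable.of_bound
    (measurable_cauchyKernel.comp
      (measurable_prodMk_left (x := ((ω, η) : ℝ × ℝ)))).aestronglyMeasurable
    η⁻¹ (Filter.Eventually.of_forall fun τ => norm_cauchyKernel_le hη ω τ)

theorem stieltjes_re (ν : Measure ℝ) [IsFiniteMeasure ν] {η : ℝ} (hη : 0 < η) (ω : ℝ) :
    (stieltjes ν ω η).re = ∫ τ, (cauchyKernel ω η τ).re ∂ν :=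
  (integral_re (integrable_cauchyKernel ν hη ω)).symm

theorem stieltjes_im (ν : Measure ℝ) [IsFiniteMeasure ν] {η : ℝ} (hη : 0 < η) (ω : ℝ) :
    (stieltjes ν ω η).im = ∫ τ, (cauchyKernel ω η τ).im ∂ν :=
  (integral_im (integrable_cauchyKernel ν hη ω)).symm

theorem stronglyMeasurable_stieltjes (ν : Measure ℝ) [SFinite ν] :
    StronglyMeasurable fun p : ℝ × ℝ => stieltjes ν p.1 p.2 :=
  measurable_cauchyKernel.stronglyMeasurable.integral_prod_right'

theorem norm_stieltjes_le (ν : Measure ℝ) [IsProbabilityMeasure ν] {η : ℝ} (hη : 0 < η) (ω : ℝ) :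
    ‖stieltjes ν ω η‖ ≤ η⁻¹ := by
  have := norm_integral_le_of_norm_le_const (μ := ν) (f := cauchyKernel ω η)
    (Filter.Eventually.of_forall fun τ => norm_cauchyKernel_le hη ω τ)
  simpa [stieltjes] using this

theorem integral_cauchyKernel_re_vertical {η h : ℝ} (hη : 0 < η) (hh : η ≤ h) (a τ : ℝ) :
    ∫ u in η..h, (cauchyKernel a u τ).re =
      Real.arctan ((τ - a) / η) - Real.arctan ((τ - a) / h) := by
  have hpos : ∀ u ∈ Set.uIcc η h, 0 < u := fun u hu => by
    rw [Set.uIcc_of_le hh] at hu; exact hη.trans_le hu.1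
  rw [intervalIntegral.integral_eq_sub_of_hasDerivAt
    (f := fun u => -Real.arctan ((τ - a) / u))]
  · ring
  · intro u hu
    have hu := hpos u hu
    have h1 : HasDerivAt (fun u => (τ - a) / u) (-(τ - a) / u ^ 2) u := by
      simpa only [neg_div, div_eq_mul_inv, mul_neg, neg_mul] using
        (hasDerivAt_inv hu.ne').const_mul (τ - a)
    convert! h1.arctan.neg using 1
    rw [cauchyKernel_re]
    have : 0 < (τ - a) ^ 2 + u ^ 2 := by positivity
    field_simp
    ring
  · refine ContinuousOn.intervalIntegrable ?_
    simp only [cauchyKernel_re]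
    refine continuousOn_const.div (by fun_prop) fun u hu => ?_
    have := hpos u hu
    positivity

theorem integral_cauchyKernel_im_horizontal {h : ℝ} (hh : 0 < h) (a b τ : ℝ) :
    ∫ ω in a..b, (cauchyKernel ω h τ).im =
      Real.arctan ((τ - a) / h) - Real.arctan ((τ - b) / h) := by
  rw [intervalIntegral.integral_eq_sub_of_hasDerivAt
    (f := fun u => -Real.arctan ((τ - u) / h))]
  · ring
  · intro u _
    have h1 : HasDerivAt (fun u => (τ - u) / h) (-1 / h) u :=
      ((hasDerivAt_id u).const_sub τ).div_const h
    convert! h1.arctan.neg using 1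
    rw [cauchyKernel_im]
    have : 0 < (τ - u) ^ 2 + h ^ 2 := by positivity
    field_simp
    ring
  · refine Continuous.intervalIntegrable ?_ _ _
    simp only [cauchyKernel_im]
    exact continuous_const.div (by fun_prop) fun u => by positivity

/-- Fubini for the Stieltjes transform along a vertical segment. -/
theorem integral_stieltjes_re_vertical (ν : Measure ℝ) [IsFiniteMeasure ν] {η h : ℝ} (hη : 0 < η)
    (hh : η ≤ h) (a : ℝ) :
    ∫ u in η..h, (stieltjes ν a u).re =
      ∫ τ, (Real.arctan ((τ - a) / η) - Real.arctan ((τ - a) / h)) ∂ν := by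
  simp_rw [← integral_cauchyKernel_re_vertical hη hh]
  rw [← intervalIntegral_integral_swap]
  · refine intervalIntegral.integral_congr fun u hu => ?_
    rw [Set.uIcc_of_le hh] at hu
    exact stieltjes_re ν (hη.trans_le hu.1) a
  · have : IsFiniteMeasure (volume.restrict (Set.uIoc η h)) := ⟨by simp [Set.uIoc]⟩
    refine Integrable.of_bound (C := η⁻¹) ?_ ?_
    · refine Measurable.aestronglyMeasurable ?_
      exact measurable_re.comp (measurable_cauchyKernel.comp
        ((measurable_const.prodMk measurable_fst).prodMk measurable_snd))
    · rw [Set.uIoc_of_le hh, ← Measure.restrict_univ (μ := ν), Measure.prod_restrict]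
      refine (ae_restrict_iff' (measurableSet_Ioc.prod .univ)).2
        (Filter.Eventually.of_forall fun p hp => ?_)
      have hp1 : η < p.1 := hp.1.1
      calc _ ≤ ‖cauchyKernel a p.1 p.2‖ := abs_re_le_norm _
        _ ≤ p.1⁻¹ := norm_cauchyKernel_le (hη.trans hp1) _ _
        _ ≤ η⁻¹ := by gcongr

/-- Fubini for the Stieltjes transform along a horizontal segment. -/
theorem integral_stieltjes_im_horizontal (ν : Measure ℝ) [IsFiniteMeasure ν] {h : ℝ} (hh : 0 < h)
    (a b : ℝ) :
    ∫ ω in a..b, (stieltjes ν ω h).im =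
      ∫ τ, (Real.arctan ((τ - a) / h) - Real.arctan ((τ - b) / h)) ∂ν := by
  simp_rw [← integral_cauchyKernel_im_horizontal hh]
  rw [← intervalIntegral_integral_swap]
  · simp_rw [stieltjes_im ν hh]
  · have : IsFiniteMeasure (volume.restrict (Set.uIoc a b)) := ⟨by simp [Set.uIoc]⟩
    refine Integrable.of_bound (C := h⁻¹) ?_ (Filter.Eventually.of_forall fun p => ?_)
    · refine Measurable.aestronglyMeasurable ?_
      exact measurable_im.comp (measurable_cauchyKernel.comp
        ((measurable_fst.prodMk measurable_const).prodMk measurable_snd))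
    · exact (abs_im_le_norm _).trans (norm_cauchyKernel_le hh _ _)

theorem abs_pi_mul_measure_Icc_sub_le (ν : Measure ℝ) [IsProbabilityMeasure ν]
    {η₁ η₂ τ₁ τ₂ a b h : ℝ} (h₁ : 0 < η₁) (h₂ : 0 < η₂) (hh₁ : η₁ ≤ h) (hh₂ : η₂ ≤ h)
    (hτ : τ₁ < τ₂) (ha : a ∈ Set.Icc (τ₁ - η₁) τ₁) (hb : b ∈ Set.Icc τ₂ (τ₂ + η₂)) :
    |Real.pi * (ν (Set.Icc τ₁ τ₂)).toReal -
        ((∫ u in η₁..h, (stieltjes ν a u).re) + (∫ ω in a..b, (stieltjes ν ω h).im) -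
          (∫ u in η₂..h, (stieltjes ν b u).re) +
          η₁ * (stieltjes ν a η₁).re - η₂ * (stieltjes ν b η₂).re)| ≤
      15 * (η₁ * (stieltjes ν a η₁).im) + 15 * (η₂ * (stieltjes ν b η₂).im) := by
  have hh : 0 < h := h₁.trans_le hh₁
  have hat : ∀ c s : ℝ, Integrable (fun τ => Real.arctan ((τ - c) / s)) ν := fun c s =>
    Integrable.of_bound (C := Real.pi / 2)
      (Real.continuous_arctan.comp (by fun_prop)).aestronglyMeasurable
      (Filter.Eventually.of_forall fun τ => abs_le.2
        ⟨(Real.neg_pi_div_two_lt_arctan _).le, (Real.arctan_lt_pi_div_two _).le⟩)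
  have hind : Integrable ((Set.Icc τ₁ τ₂).indicator (1 : ℝ → ℝ)) ν :=
    (integrable_const (1 : ℝ)).indicator measurableSet_Icc
  have hre : ∀ (c : ℝ) {s : ℝ}, 0 < s → Integrable (fun τ => (cauchyKernel c s τ).re) ν :=
    fun c s hs => (integrable_cauchyKernel ν hs c).re
  have him : ∀ (c : ℝ) {s : ℝ}, 0 < s → Integrable (fun τ => (cauchyKernel c s τ).im) ν :=
    fun c s hs => (integrable_cauchyKernel ν hs c).im
  have hlhs : Real.pi * (ν (Set.Icc τ₁ τ₂)).toReal -
        ((∫ u in η₁..h, (stieltjes ν a u).re) + (∫ ω in a..b, (stieltjes ν ω h).im) -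
          (∫ u in η₂..h, (stieltjes ν b u).re) +
          η₁ * (stieltjes ν a η₁).re - η₂ * (stieltjes ν b η₂).re) =
      ∫ τ, (Real.pi * (Set.Icc τ₁ τ₂).indicator 1 τ -
        ((Real.arctan ((τ - a) / η₁) - Real.arctan ((τ - a) / h)) +
          (Real.arctan ((τ - a) / h) - Real.arctan ((τ - b) / h)) -
          (Real.arctan ((τ - b) / η₂) - Real.arctan ((τ - b) / h)) +
          η₁ * (cauchyKernel a η₁ τ).re - η₂ * (cauchyKernel b η₂ τ).re)) ∂ν := by
    have i1 := (hat a η₁).sub (hat a h)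
    have i2 := (hat a h).sub (hat b h)
    have i3 := (hat b η₂).sub (hat b h)
    have i4 := (hre a h₁).const_mul η₁
    have i5 := (hre b h₂).const_mul η₂
    refine ((integral_sub (hind.const_mul _) ((((i1.add i2).sub i3).add i4).sub i5)).trans ?_).symm
    rw [integral_sub' (((i1.add i2).sub i3).add i4) i5, integral_add' ((i1.add i2).sub i3) i4,
      integral_sub' (i1.add i2) i3, integral_add' i1 i2, integral_const_mul, integral_const_mul,
      integral_const_mul, integral_indicator_one measurableSet_Icc]
    simp only [Pi.sub_apply]
    rw [← integral_stieltjes_re_vertical ν h₁ hh₁, ← integral_stieltjes_re_vertical ν h₂ hh₂,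
      ← integral_stieltjes_im_horizontal ν hh, ← stieltjes_re ν h₁, ← stieltjes_re ν h₂]
    rfl
  have hrhs : 15 * (η₁ * (stieltjes ν a η₁).im) + 15 * (η₂ * (stieltjes ν b η₂).im) =
      ∫ τ, (15 * (η₁ * (cauchyKernel a η₁ τ).im) + 15 * (η₂ * (cauchyKernel b η₂ τ).im)) ∂ν := by
    rw [integral_add (((him a h₁).const_mul η₁).const_mul 15)
      (((him b h₂).const_mul η₂).const_mul 15)]
    simp only [integral_const_mul]
    rw [stieltjes_im ν h₁, stieltjes_im ν h₂]
  rw [hlhs, hrhs, ← Real.norm_eq_abs]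
  refine norm_integral_le_of_norm_le ((((him a h₁).const_mul η₁).const_mul 15).add
      (((him b h₂).const_mul η₂).const_mul 15)) (Filter.Eventually.of_forall fun τ => ?_)
  have e1 := abs_le.1 (abs_indicator_Icc_sub_sign_le h₁ h₂ hτ ha hb τ)
  have e2 := abs_le.1 (abs_arctan_div_add_conjPoisson_sub_sign_le h₁ (τ - a))
  have e3 := abs_le.1 (abs_arctan_div_add_conjPoisson_sub_sign_le h₂ (τ - b))
  simp only [cauchyKernel_re, cauchyKernel_im, Real.norm_eq_abs]
  rw [abs_le]
  constructor <;> linarith [e1.1, e1.2, e2.1, e2.2, e3.1, e3.2]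

theorem measurable_norm_stieltjes_sub (ν₁ ν₂ : Measure ℝ) [SFinite ν₁] [SFinite ν₂] :
    Measurable fun p : ℝ × ℝ => ‖stieltjes ν₁ p.1 p.2 - stieltjes ν₂ p.1 p.2‖ :=
  ((stronglyMeasurable_stieltjes ν₁).sub (stronglyMeasurable_stieltjes ν₂)).norm.measurable

theorem norm_stieltjes_sub_le (ν₁ ν₂ : Measure ℝ) [IsProbabilityMeasure ν₁]
    [IsProbabilityMeasure ν₂] {c η : ℝ} (hc : 0 < c) (hη : c ≤ η) (ω : ℝ) :
    ‖stieltjes ν₁ ω η - stieltjes ν₂ ω η‖ ≤ 2 * c⁻¹ := by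
  have hη0 := hc.trans_le hη
  have h1 := norm_stieltjes_le ν₁ hη0 ω
  have h2 := norm_stieltjes_le ν₂ hη0 ω
  have h3 : η⁻¹ ≤ c⁻¹ := by gcongr
  linarith [norm_sub_le (stieltjes ν₁ ω η) (stieltjes ν₂ ω η)]

theorem integrableOn_stieltjes_horizontal (ν : Measure ℝ) [IsProbabilityMeasure ν] {η : ℝ}
    (hη : 0 < η) (a b : ℝ) : IntegrableOn (fun ω => stieltjes ν ω η) (Set.Icc a b) :=
  Measure.integrableOn_of_bounded (M := η⁻¹) measure_Icc_lt_top.ne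
    ((stronglyMeasurable_stieltjes ν).comp_measurable
      (measurable_prodMk_right (y := η))).aestronglyMeasurable
    (Filter.Eventually.of_forall fun ω => norm_stieltjes_le ν hη ω)

theorem integrableOn_stieltjes_vertical (ν : Measure ℝ) [IsProbabilityMeasure ν] {η : ℝ}
    (hη : 0 < η) (h ω : ℝ) : IntegrableOn (fun u => stieltjes ν ω u) (Set.Icc η h) := by
  refine Measure.integrableOn_of_bounded (M := η⁻¹) measure_Icc_lt_top.ne
    ((stronglyMeasurable_stieltjes ν).comp_measurable
      (measurable_prodMk_left (x := ω))).aestronglyMeasurable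
    ((ae_restrict_iff' measurableSet_Icc).2 (Filter.Eventually.of_forall fun u hu => ?_))
  exact (norm_stieltjes_le ν (hη.trans_le hu.1) ω).trans (by gcongr; exact hu.1)

theorem abs_intervalIntegral_sub_intervalIntegral_le {f g d : ℝ → ℝ} {a b a' b' : ℝ} (hab : a ≤ b)
    (ha : a' ≤ a) (hb : b ≤ b') (hf : IntegrableOn f (Set.Icc a b))
    (hg : IntegrableOn g (Set.Icc a b)) (hd : IntegrableOn d (Set.Icc a' b'))
    (hd0 : ∀ x, 0 ≤ d x) (hle : ∀ x, |f x - g x| ≤ d x) :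
    |(∫ x in a..b, f x) - ∫ x in a..b, g x| ≤ ∫ x in Set.Icc a' b', d x := by
  rw [intervalIntegral.integral_of_le hab, intervalIntegral.integral_of_le hab,
    ← integral_Icc_eq_integral_Ioc, ← integral_Icc_eq_integral_Ioc, ← integral_sub hf hg]
  have hsub : Set.Icc a b ⊆ Set.Icc a' b' := Set.Icc_subset_Icc ha hb
  refine (norm_integral_le_of_norm_le (f := fun x => f x - g x) (hd.mono_set hsub)
    (Filter.Eventually.of_forall hle)).trans ?_
  exact setIntegral_mono_set hd (Filter.Eventually.of_forall hd0) hsub.eventuallyLE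

theorem im_stieltjes_nonneg (ν : Measure ℝ) [IsFiniteMeasure ν] {η : ℝ} (hη : 0 < η) (ω : ℝ) :
    0 ≤ (stieltjes ν ω η).im := by
  rw [stieltjes_im ν hη]
  refine integral_nonneg fun τ => ?_
  simp only [cauchyKernel_im, Pi.zero_apply]
  positivity

/-- The bound through a single rectangular contour. -/
theorem abs_measure_Icc_sub_le_of_contour (ν₁ ν₂ : Measure ℝ) [IsProbabilityMeasure ν₁]
    [IsProbabilityMeasure ν₂] {η₁ η₂ ε τ₁ τ₂ a b h : ℝ} (h₁ : 0 < η₁) (h₂ : 0 < η₂)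
    (hh₁ : η₁ ≤ h) (hh₂ : η₂ ≤ h) (hε : h ≤ 2 * ε)
    (hτ : τ₁ < τ₂) (ha : a ∈ Set.Icc (τ₁ - η₁) τ₁) (hb : b ∈ Set.Icc τ₂ (τ₂ + η₂)) :
    |(ν₁ (Set.Icc τ₁ τ₂)).toReal - (ν₂ (Set.Icc τ₁ τ₂)).toReal| ≤
      31 * (η₁ * ((stieltjes ν₁ a η₁).im + ‖stieltjes ν₁ a η₁ - stieltjes ν₂ a η₁‖ +
        η₁⁻¹ * ∫ η in Set.Icc η₁ (2 * ε), ‖stieltjes ν₁ a η - stieltjes ν₂ a η‖)) +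
      31 * (η₂ * ((stieltjes ν₁ b η₂).im + ‖stieltjes ν₁ b η₂ - stieltjes ν₂ b η₂‖ +
        η₂⁻¹ * ∫ η in Set.Icc η₂ (2 * ε), ‖stieltjes ν₁ b η - stieltjes ν₂ b η‖)) +
      ∫ ω in Set.Icc (τ₁ - η₁) (τ₂ + η₂), ‖stieltjes ν₁ ω h - stieltjes ν₂ ω h‖ := by
  have hh : 0 < h := h₁.trans_le hh₁
  have hvert : ∀ (c : ℝ) {η : ℝ}, 0 < η → η ≤ h →
      |(∫ u in η..h, (stieltjes ν₁ c u).re) - ∫ u in η..h, (stieltjes ν₂ c u).re| ≤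
        ∫ u in Set.Icc η (2 * ε), ‖stieltjes ν₁ c u - stieltjes ν₂ c u‖ := fun c η hη hηh =>
    abs_intervalIntegral_sub_intervalIntegral_le hηh le_rfl hε
      (integrableOn_stieltjes_vertical ν₁ hη h c).re (integrableOn_stieltjes_vertical ν₂ hη h c).re
      ((integrableOn_stieltjes_vertical ν₁ hη _ c).sub
        (integrableOn_stieltjes_vertical ν₂ hη _ c)).norm
      (fun _ => norm_nonneg _) fun _ => by
        rw [← sub_re]; exact abs_re_le_norm _
  have hhor : |(∫ ω in a..b, (stieltjes ν₁ ω h).im) - ∫ ω in a..b, (stieltjes ν₂ ω h).im| ≤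
      ∫ ω in Set.Icc (τ₁ - η₁) (τ₂ + η₂), ‖stieltjes ν₁ ω h - stieltjes ν₂ ω h‖ :=
    abs_intervalIntegral_sub_intervalIntegral_le (by linarith [ha.2, hb.1]) ha.1 hb.2
      (integrableOn_stieltjes_horizontal ν₁ hh _ _).im
      (integrableOn_stieltjes_horizontal ν₂ hh _ _).im
      ((integrableOn_stieltjes_horizontal ν₁ hh _ _).sub
        (integrableOn_stieltjes_horizontal ν₂ hh _ _)).norm
      (fun _ => norm_nonneg _) fun _ => by
        rw [← sub_im]; exact abs_im_le_norm _
  have hre : ∀ (c : ℝ) {η : ℝ}, 0 < η →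
      |η * (stieltjes ν₁ c η).re - η * (stieltjes ν₂ c η).re| ≤
        η * ‖stieltjes ν₁ c η - stieltjes ν₂ c η‖ := fun c η hη => by
    rw [← mul_sub, abs_mul, abs_of_pos hη, ← sub_re]
    gcongr
    exact abs_re_le_norm _
  have him : ∀ (c : ℝ) {η : ℝ}, 0 < η → η * (stieltjes ν₂ c η).im ≤
      η * (stieltjes ν₁ c η).im + η * ‖stieltjes ν₁ c η - stieltjes ν₂ c η‖ := fun c η hη => by
    rw [← mul_add]
    gcongr
    have := neg_abs_le (stieltjes ν₁ c η - stieltjes ν₂ c η).im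
    have := abs_im_le_norm (stieltjes ν₁ c η - stieltjes ν₂ c η)
    rw [sub_im] at *
    linarith
  have hpos : ∀ (c : ℝ) {η : ℝ}, 0 < η → 0 ≤ η * (stieltjes ν₁ c η).im ∧
      0 ≤ ∫ u in Set.Icc η (2 * ε), ‖stieltjes ν₁ c u - stieltjes ν₂ c u‖ := fun c η hη =>
    ⟨mul_nonneg hη.le (im_stieltjes_nonneg ν₁ hη c), integral_nonneg fun _ => norm_nonneg _⟩
  have hpi : |(ν₁ (Set.Icc τ₁ τ₂)).toReal - (ν₂ (Set.Icc τ₁ τ₂)).toReal| ≤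
      |Real.pi * (ν₁ (Set.Icc τ₁ τ₂)).toReal - Real.pi * (ν₂ (Set.Icc τ₁ τ₂)).toReal| := by
    rw [← mul_sub, abs_mul, abs_of_pos Real.pi_pos]
    exact le_mul_of_one_le_left (abs_nonneg _) (by linarith [Real.two_le_pi])
  refine hpi.trans ?_
  have f1 := abs_le.1 (abs_pi_mul_measure_Icc_sub_le ν₁ h₁ h₂ hh₁ hh₂ hτ ha hb)
  have f2 := abs_le.1 (abs_pi_mul_measure_Icc_sub_le ν₂ h₁ h₂ hh₁ hh₂ hτ ha hb)
  have v1 := abs_le.1 (hvert a h₁ hh₁)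
  have v2 := abs_le.1 (hvert b h₂ hh₂)
  have hz := abs_le.1 hhor
  have r1 := abs_le.1 (hre a h₁)
  have r2 := abs_le.1 (hre b h₂)
  have g1 := him a h₁
  have g2 := him b h₂
  have p1 := hpos a h₁
  have p2 := hpos b h₂
  rw [mul_add, mul_add, mul_inv_cancel_left₀ h₁.ne', mul_add η₂, mul_add η₂,
    mul_inv_cancel_left₀ h₂.ne', abs_le]
  constructor <;>
    linarith [f1.1, f1.2, f2.1, f2.2, v1.1, v1.2, v2.1, v2.2, hz.1, hz.2, r1.1, r1.2, r2.1, r2.2,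
      p1.1, p1.2, p2.1, p2.2]

theorem exists_mem_Icc_mul_le_setIntegral {f : ℝ → ℝ} {a b : ℝ} (hab : a < b)
    (hf : IntegrableOn f (Set.Icc a b)) :
    ∃ x ∈ Set.Icc a b, (b - a) * f x ≤ ∫ y in Set.Icc a b, f y := by
  obtain ⟨x, hx, hle⟩ := exists_le_setAverage (μ := volume) (s := Set.Icc a b)
    (by simpa using hab) measure_Icc_lt_top.ne hf
  refine ⟨x, hx, ?_⟩
  rw [setAverage_eq, measureReal_def, Real.volume_Icc, ENNReal.toReal_ofReal (by linarith),
    smul_eq_mul] at hle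
  rwa [← le_inv_mul_iff₀ (by linarith)]

theorem integrableOn_local_bound (ν₁ ν₂ : Measure ℝ) [IsProbabilityMeasure ν₁]
    [IsProbabilityMeasure ν₂] {η : ℝ} (hη : 0 < η) (ε a b : ℝ) :
    IntegrableOn (fun ω => (stieltjes ν₁ ω η).im + ‖stieltjes ν₁ ω η - stieltjes ν₂ ω η‖ +
      η⁻¹ * ∫ u in Set.Icc η (2 * ε), ‖stieltjes ν₁ ω u - stieltjes ν₂ ω u‖) (Set.Icc a b) := by
  have i1 := integrableOn_stieltjes_horizontal ν₁ hη a b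
  refine (i1.im.add (i1.sub (integrableOn_stieltjes_horizontal ν₂ hη a b)).norm).add
    (Integrable.const_mul ?_ _)
  refine Measure.integrableOn_of_bounded
    (M := 2 * η⁻¹ * volume.real (Set.Icc η (2 * ε))) measure_Icc_lt_top.ne
    (measurable_norm_stieltjes_sub ν₁ ν₂).stronglyMeasurable.integral_prod_right'.aestronglyMeasurable
    (Filter.Eventually.of_forall fun ω => ?_)
  refine norm_setIntegral_le_of_norm_le_const measure_Icc_lt_top fun u hu => ?_
  rw [norm_norm]
  exact norm_stieltjes_sub_le ν₁ ν₂ hη hu.1 ω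

theorem integrable_norm_stieltjes_sub_rectangle (ν₁ ν₂ : Measure ℝ) [IsProbabilityMeasure ν₁]
    [IsProbabilityMeasure ν₂] {ε : ℝ} (hε : 0 < ε) (h a b : ℝ) :
    Integrable (Function.uncurry fun ω η => ‖stieltjes ν₁ ω η - stieltjes ν₂ ω η‖)
      ((volume.restrict (Set.Icc a b)).prod (volume.restrict (Set.Icc ε h))) := by
  refine Integrable.of_bound (C := 2 * ε⁻¹)
    (measurable_norm_stieltjes_sub ν₁ ν₂).aestronglyMeasurable ?_
  rw [Measure.prod_restrict]
  refine (ae_restrict_iff' (measurableSet_Icc.prod measurableSet_Icc)).2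
    (Filter.Eventually.of_forall fun p hp => ?_)
  simp only [Function.uncurry, norm_norm]
  exact norm_stieltjes_sub_le ν₁ ν₂ hε hp.2.1 p.1

/-- Lemma A.2: the difference of two probability measures on an interval is
controlled by their Stieltjes transforms.  Here `m ν z = ∫ (τ − z)⁻¹ dν(τ)`
and the Stieltjes transform of the signed measure `ν₁ − ν₂` is
`m ν₁ z − m ν₂ z`. -/
theorem measure_difference_via_stieltjes :
    ∃ C : ℝ, 0 < C ∧
      ∀ (ν₁ ν₂ : Measure ℝ), IsProbabilityMeasure ν₁ → IsProbabilityMeasure ν₂ →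
        ∀ (η₁ η₂ ε : ℝ), η₁ ∈ Set.Ioc (0:ℝ) 1 → η₂ ∈ Set.Ioc (0:ℝ) 1 →
          ε ∈ Set.Ioc (0:ℝ) 1 → max η₁ η₂ ≤ ε →
        ∀ (τ₁ τ₂ : ℝ), τ₁ < τ₂ →
        |(ν₁ (Set.Icc τ₁ τ₂)).toReal - (ν₂ (Set.Icc τ₁ τ₂)).toReal| ≤
          C * ((ν₁ (Set.Icc (τ₁ - η₁) τ₁)).toReal +
            (ν₁ (Set.Icc τ₂ (τ₂ + η₂))).toReal +
            -- J₁
            (∫ ω in Set.Icc (τ₁ - η₁) τ₁,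
              ((∫ τ : ℝ, ((τ:ℂ) - (ω + η₁ * Complex.I))⁻¹ ∂ν₁).im +
                ‖(∫ τ : ℝ, ((τ:ℂ) - (ω + η₁ * Complex.I))⁻¹ ∂ν₁) -
                  (∫ τ : ℝ, ((τ:ℂ) - (ω + η₁ * Complex.I))⁻¹ ∂ν₂)‖ +
                η₁⁻¹ * ∫ η in Set.Icc η₁ (2 * ε),
                  ‖(∫ τ : ℝ, ((τ:ℂ) - (ω + η * Complex.I))⁻¹ ∂ν₁) -
                    (∫ τ : ℝ, ((τ:ℂ) - (ω + η * Complex.I))⁻¹ ∂ν₂)‖)) +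
            -- J₂
            (∫ ω in Set.Icc τ₂ (τ₂ + η₂),
              ((∫ τ : ℝ, ((τ:ℂ) - (ω + η₂ * Complex.I))⁻¹ ∂ν₁).im +
                ‖(∫ τ : ℝ, ((τ:ℂ) - (ω + η₂ * Complex.I))⁻¹ ∂ν₁) -
                  (∫ τ : ℝ, ((τ:ℂ) - (ω + η₂ * Complex.I))⁻¹ ∂ν₂)‖ +
                η₂⁻¹ * ∫ η in Set.Icc η₂ (2 * ε),
                  ‖(∫ τ : ℝ, ((τ:ℂ) - (ω + η * Complex.I))⁻¹ ∂ν₁) -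
                    (∫ τ : ℝ, ((τ:ℂ) - (ω + η * Complex.I))⁻¹ ∂ν₂)‖)) +
            -- J₃
            ε⁻¹ * ∫ ω in Set.Icc (τ₁ - η₁) (τ₂ + η₂),
              ∫ η in Set.Icc ε (2 * ε),
                ‖(∫ τ : ℝ, ((τ:ℂ) - (ω + η * Complex.I))⁻¹ ∂ν₁) -
                  (∫ τ : ℝ, ((τ:ℂ) - (ω + η * Complex.I))⁻¹ ∂ν₂)‖) := by
  refine ⟨31, by norm_num, fun ν₁ ν₂ _ _ η₁ η₂ ε ⟨h₁, _⟩ ⟨h₂, _⟩ ⟨hε, _⟩ hmax τ₁ τ₂ hτ => ?_⟩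
  simp only [← cauchyKernel.eq_def, ← stieltjes.eq_def]
  have hε₁ : η₁ ≤ ε := (le_max_left _ _).trans hmax
  have hε₂ : η₂ ≤ ε := (le_max_right _ _).trans hmax
  have hrect := integrable_norm_stieltjes_sub_rectangle ν₁ ν₂ hε (2 * ε) (τ₁ - η₁) (τ₂ + η₂)
  obtain ⟨a, ha, hJa⟩ := exists_mem_Icc_mul_le_setIntegral (by linarith)
    (integrableOn_local_bound ν₁ ν₂ h₁ ε (τ₁ - η₁) τ₁)
  obtain ⟨b, hb, hJb⟩ := exists_mem_Icc_mul_le_setIntegral (by linarith)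
    (integrableOn_local_bound ν₁ ν₂ h₂ ε τ₂ (τ₂ + η₂))
  obtain ⟨h, hh, hJh⟩ := exists_mem_Icc_mul_le_setIntegral (a := ε) (b := 2 * ε) (by linarith)
    hrect.integral_prod_right
  simp only [Function.uncurry_apply_pair] at hJh
  rw [sub_sub_cancel] at hJa
  rw [add_sub_cancel_left] at hJb
  rw [show 2 * ε - ε = ε by ring, ← integral_integral_swap hrect, ← le_inv_mul_iff₀ hε] at hJh
  have key := abs_measure_Icc_sub_le_of_contour ν₁ ν₂ h₁ h₂ (hε₁.trans hh.1) (hε₂.trans hh.1) hh.2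
    hτ ha hb
  have h0 : 0 ≤ ∫ ω in Set.Icc (τ₁ - η₁) (τ₂ + η₂), ‖stieltjes ν₁ ω h - stieltjes ν₂ ω h‖ :=
    integral_nonneg fun _ => norm_nonneg _
  have hm₁ : 0 ≤ (ν₁ (Set.Icc (τ₁ - η₁) τ₁)).toReal := ENNReal.toReal_nonneg
  have hm₂ : 0 ≤ (ν₁ (Set.Icc τ₂ (τ₂ + η₂))).toReal := ENNReal.toReal_nonneg
  linarith
end

section
/- Let f : ℝ → ℝ be a C² compactly supported function and χ : ℝ → ℝ a C¹ compactly supported even function with χ(0) = 1. Then for every τ ∈ ℝ, f(τ) = (1/2π) Re ∫_{ℝ²} [iη f''(σ) χ(η) + i(f(σ) + iη f'(σ)) χ'(η)] / (τ − σ − iη) dσ dη. -/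
open MeasureTheory Complex Real

lemma abs_le_two_mul_of_polar {r θ R : ℝ} (hc : |r * Real.cos θ| ≤ R)
    (hs : |r * Real.sin θ| ≤ R) : |r| ≤ 2 * R := by
  have hR : 0 ≤ R := (abs_nonneg _).trans hc
  refine abs_le_of_sq_le_sq ?_ (by positivity)
  have h1 := sq_le_sq' (abs_le.1 hc).1 (abs_le.1 hc).2
  have h2 := sq_le_sq' (abs_le.1 hs).1 (abs_le.1 hs).2
  nlinarith [Real.sin_sq_add_cos_sq θ]

/-- A compactly supported function on the plane vanishes, in polar coordinates, at large radii. -/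
lemma HasCompactSupport.exists_polar_radius {E : Type*} [Zero E] {G : ℝ × ℝ → E}
    (hG : HasCompactSupport G) :
    ∃ R : ℝ, ∀ r θ : ℝ, R < |r| → G (r * Real.cos θ, r * Real.sin θ) = 0 := by
  obtain ⟨R, hR⟩ := hG.isCompact.isBounded.exists_norm_le
  refine ⟨2 * R, fun r θ hr => ?_⟩
  by_contra hne
  have h := hR _ (subset_tsupport G hne)
  rw [Prod.norm_def, max_le_iff] at h
  exact hr.not_ge (abs_le_two_mul_of_polar h.1 h.2)

lemma integrableOn_polar_target {E : Type*} [NormedAddCommGroup E] {G : ℝ × ℝ → E}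
    (hG : Continuous G) {R : ℝ} (hR : ∀ q : ℝ × ℝ, R < |q.1| → G q = 0) :
    IntegrableOn G (Set.Ioi 0 ×ˢ Set.Ioo (-π) π) := by
  have hK : IsCompact (Set.Icc 0 R ×ˢ Set.Icc (-π) π) := isCompact_Icc.prod isCompact_Icc
  refine (hG.continuousOn.integrableOn_compact hK).of_forall_sdiff_eq_zero
    (measurableSet_Ioi.prod measurableSet_Ioo) ?_
  rintro ⟨r, θ⟩ ⟨⟨hr, hθ⟩, hn⟩
  refine hR _ ?_
  by_contra! h
  exact hn ⟨⟨le_of_lt hr, (le_abs_self _).trans h⟩, Set.Ioo_subset_Icc_self hθ⟩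

/-- In polar coordinates, the radial derivative of a compactly supported `C¹` function integrates
to `-2π` times its value at the origin. -/
lemma integral_radial_deriv {F : ℝ × ℝ → ℂ} (hF : ContDiff ℝ 1 F) (hFc : HasCompactSupport F) :
    ∫ q in Set.Ioi (0 : ℝ) ×ˢ Set.Ioo (-π) π,
      fderiv ℝ F (q.1 * Real.cos q.2, q.1 * Real.sin q.2) (Real.cos q.2, Real.sin q.2) =
    -(2 * π * F 0) := by
  obtain ⟨R, hR⟩ := (hFc.fderiv (𝕜 := ℝ)).exists_polar_radius
  obtain ⟨R', hR'⟩ := hFc.exists_polar_radius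
  rw [Measure.volume_eq_prod, ← setIntegral_prod_swap, setIntegral_prod]
  · have key : ∀ θ : ℝ, ∫ r in Set.Ioi (0 : ℝ),
        fderiv ℝ F (r * Real.cos θ, r * Real.sin θ) (Real.cos θ, Real.sin θ) = -F 0 := by
      intro θ
      have hd : ∀ r : ℝ, HasDerivAt (fun r : ℝ => F (r * Real.cos θ, r * Real.sin θ))
          (fderiv ℝ F (r * Real.cos θ, r * Real.sin θ) (Real.cos θ, Real.sin θ)) r := fun r =>
        ((hF.differentiable one_ne_zero _).hasFDerivAt).comp_hasDerivAt r
          ((hasDerivAt_mul_const _).prodMk (hasDerivAt_mul_const _))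
      have hc : HasCompactSupport (fun r : ℝ => F (r * Real.cos θ, r * Real.sin θ)) := by
        refine HasCompactSupport.intro (isCompact_Icc (a := -R') (b := R')) fun r hr => hR' r θ ?_
        by_contra! h
        exact hr (abs_le.1 h)
      have h := HasCompactSupport.integral_Ioi_deriv_eq
        (f := fun r : ℝ => F (r * Real.cos θ, r * Real.sin θ)) (hF.comp ((contDiff_id.mul contDiff_const).prodMk (contDiff_id.mul contDiff_const))) hc 0
      rw [funext fun r => (hd r).deriv] at h
      simpa only [zero_mul, Prod.mk_zero_zero] using h
    simp only [Prod.swap_prod_mk, key]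
    rw [setIntegral_const, Real.volume_real_Ioo_of_le (by linarith [Real.pi_pos])]
    simp only [Complex.real_smul]
    push_cast
    ring
  · refine IntegrableOn.swap (f := fun q : ℝ × ℝ =>
      fderiv ℝ F (q.1 * Real.cos q.2, q.1 * Real.sin q.2) (Real.cos q.2, Real.sin q.2)) ?_
    exact integrableOn_polar_target (R := R) (by fun_prop) fun q hq => by simp [hR q.1 q.2 hq]

/-- In polar coordinates, the angular derivative of a compactly supported `C¹` function integrates
to zero. -/
lemma integral_angular_deriv {F : ℝ × ℝ → ℂ} (hF : ContDiff ℝ 1 F) (hFc : HasCompactSupport F) :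
    ∫ q in Set.Ioi (0 : ℝ) ×ˢ Set.Ioo (-π) π,
      fderiv ℝ F (q.1 * Real.cos q.2, q.1 * Real.sin q.2) (-Real.sin q.2, Real.cos q.2) = 0 := by
  obtain ⟨R, hR⟩ := (hFc.fderiv (𝕜 := ℝ)).exists_polar_radius
  rw [Measure.volume_eq_prod, setIntegral_prod]
  · refine setIntegral_eq_zero_of_forall_eq_zero fun r hr => ?_
    have hr0 : (r : ℂ) ≠ 0 := by exact_mod_cast (ne_of_gt hr)
    have hd : ∀ θ : ℝ, HasDerivAt (fun θ : ℝ => F (r * Real.cos θ, r * Real.sin θ))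
        (r * fderiv ℝ F (r * Real.cos θ, r * Real.sin θ) (-Real.sin θ, Real.cos θ)) θ := by
      intro θ
      have h := ((hF.differentiable one_ne_zero _).hasFDerivAt).comp_hasDerivAt θ
        (((Real.hasDerivAt_cos θ).const_mul r).prodMk ((Real.hasDerivAt_sin θ).const_mul r))
      refine h.congr_deriv ?_
      rw [← Complex.real_smul, ← map_smul]
      simp
    have h := intervalIntegral.integral_eq_sub_of_hasDerivAt (a := -π) (b := π)
      (fun θ _ => hd θ) (Continuous.intervalIntegrable (by fun_prop) _ _)
    rw [intervalIntegral.integral_const_mul,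
      intervalIntegral.integral_of_le (by linarith [Real.pi_pos]),
      integral_Ioc_eq_integral_Ioo] at h
    simpa [hr0] using h
  · exact integrableOn_polar_target (R := R) (by fun_prop) fun q hq => by simp [hR q.1 q.2 hq]

/-- The Cauchy–Pompeiu formula at the origin for a compactly supported `C¹` function. -/
lemma cauchy_pompeiu_zero {F : ℝ × ℝ → ℂ} (hF : ContDiff ℝ 1 F) (hFc : HasCompactSupport F) :
    ∫ p : ℝ × ℝ, (fderiv ℝ F p (1, 0) + I * fderiv ℝ F p (0, 1)) / (p.1 + I * p.2) =
      -(2 * π * F 0) := by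
  obtain ⟨R, hR⟩ := (hFc.fderiv (𝕜 := ℝ)).exists_polar_radius
  rw [← integral_comp_polarCoord_symm]
  calc _ = ∫ q in Set.Ioi (0 : ℝ) ×ˢ Set.Ioo (-π) π,
        (fderiv ℝ F (q.1 * Real.cos q.2, q.1 * Real.sin q.2) (Real.cos q.2, Real.sin q.2) +
          I * fderiv ℝ F (q.1 * Real.cos q.2, q.1 * Real.sin q.2)
            (-Real.sin q.2, Real.cos q.2)) := by
        refine setIntegral_congr_fun (measurableSet_Ioi.prod measurableSet_Ioo) ?_
        rintro ⟨r, θ⟩ ⟨hr, -⟩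
        have hr0 : (r : ℂ) ≠ 0 := by exact_mod_cast (ne_of_gt hr)
        have hlin : ∀ (L : ℝ × ℝ →L[ℝ] ℂ) (a b : ℝ), L (a, b) = a * L (1, 0) + b * L (0, 1) := by
          intro L a b
          rw [← Complex.real_smul, ← Complex.real_smul, ← map_smul, ← map_smul, ← map_add]
          simp
        have hsc : (Real.sin θ : ℂ) ^ 2 + (Real.cos θ : ℂ) ^ 2 = 1 := by
          exact_mod_cast Real.sin_sq_add_cos_sq θ
        have hne : (Real.cos θ : ℂ) + I * Real.sin θ ≠ 0 := by
          intro h0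
          have : ((Real.cos θ : ℂ) + I * Real.sin θ) * (Real.cos θ - I * Real.sin θ) = 1 := by
            linear_combination hsc - (Real.sin θ : ℂ) ^ 2 * I_sq
          rw [h0, zero_mul] at this
          exact zero_ne_one this
        simp only [polarCoord_symm_apply, Complex.real_smul]
        rw [hlin _ (Real.cos θ), hlin _ (-Real.sin θ)]
        generalize fderiv ℝ F _ (1, 0) = a
        generalize fderiv ℝ F _ (0, 1) = b
        push_cast only [Complex.ofReal_mul, Complex.ofReal_neg]
        generalize (Real.cos θ : ℂ) = c at *
        generalize (Real.sin θ : ℂ) = s at *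
        have hden : (r : ℂ) * c + I * (r * s) = r * (c + I * s) := by ring
        rw [hden, mul_div_assoc', mul_div_mul_left _ _ hr0, div_eq_iff hne]
        linear_combination (-(a + I * b)) * hsc + (a * s ^ 2 - b * c * s) * I_sq
    _ = _ := by
        rw [integral_add, integral_const_mul, integral_radial_deriv hF hFc,
          integral_angular_deriv hF hFc]
        · simp
        · exact integrableOn_polar_target (R := R) (by fun_prop) fun q hq => by simp [hR q.1 q.2 hq]
        · exact integrableOn_polar_target (R := R) (by fun_prop) fun q hq => by simp [hR q.1 q.2 hq]

/-- The Cauchy–Pompeiu formula for a compactly supported `C¹` function on the plane. -/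
lemma cauchy_pompeiu {F : ℝ × ℝ → ℂ} (hF : ContDiff ℝ 1 F) (hFc : HasCompactSupport F)
    (z : ℝ × ℝ) :
    ∫ p : ℝ × ℝ, (fderiv ℝ F p (1, 0) + I * fderiv ℝ F p (0, 1)) /
      ((z.1 - p.1) + I * (z.2 - p.2)) = 2 * π * F z := by
  have h := cauchy_pompeiu_zero (F := fun p => F (z + p))
    (hF.comp (contDiff_const.add contDiff_id)) (hFc.comp_homeomorph (Homeomorph.addLeft z))
  simp only [fderiv_comp_add_left, add_zero] at h
  rw [← integral_add_left_eq_self _ z, ← neg_eq_iff_eq_neg.2 h, ← integral_neg]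
  congr 1 with p
  rw [← div_neg]
  congr 1
  simp only [Prod.fst_add, Prod.snd_add]
  push_cast
  ring

/-- Helffer–Sjöstrand representation formula: for `f` a `C²` compactly
supported real function and `χ` a `C¹` compactly supported even cutoff with
`χ(0) = 1`,
`f(τ) = (1/2π) Re ∫_{ℝ²} [iη f''(σ) χ(η) + i(f(σ)+iη f'(σ)) χ'(η)]
          / (τ − σ − iη) dσ dη`. -/
theorem helffer_sjostrand_formula
    (f χ : ℝ → ℝ)
    (hf : ContDiff ℝ 2 f) (hfc : HasCompactSupport f)
    (hχ : ContDiff ℝ 1 χ) (hχc : HasCompactSupport χ)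
    (hχeven : ∀ x, χ (-x) = χ x) (hχ0 : χ 0 = 1) (τ : ℝ) :
    f τ = (1 / (2 * π)) *
      (∫ p : ℝ × ℝ,
        ((Complex.I * (p.2 : ℂ) * Complex.ofReal (deriv (deriv f) p.1) *
              Complex.ofReal (χ p.2) +
            Complex.I * (Complex.ofReal (f p.1) +
              Complex.I * (p.2 : ℂ) * Complex.ofReal (deriv f p.1)) *
              Complex.ofReal (deriv χ p.2)) /
          ((τ : ℂ) - (p.1 : ℂ) - Complex.I * (p.2 : ℂ)))).re := by
  set F : ℝ × ℝ → ℂ := fun p => ((f p.1 : ℂ) + I * p.2 * ((deriv f p.1 : ℝ) : ℂ)) * (χ p.2 : ℂ) with hFdef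
  have hf' : ContDiff ℝ 1 (deriv f) := ((contDiff_succ_iff_deriv (n := 1)).1 hf).2.2
  have hf1 : ContDiff ℝ 1 f := hf.of_le one_le_two
  have hof : ContDiff ℝ 1 (fun x : ℝ => (x : ℂ)) := ofRealCLM.contDiff
  have hF : ContDiff ℝ 1 F :=
    ((hof.comp (hf1.comp contDiff_fst)).add ((contDiff_const.mul (hof.comp contDiff_snd)).mul
      (hof.comp (hf'.comp contDiff_fst)))).mul (hof.comp (hχ.comp contDiff_snd))
  have hFc : HasCompactSupport F := by
    refine HasCompactSupport.intro (hfc.isCompact.prod hχc.isCompact) fun p hp => ?_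
    by_cases h1 : p.1 ∈ tsupport f
    · have h2 : p.2 ∉ tsupport χ := fun h2 => hp ⟨h1, h2⟩
      simp [hFdef, image_eq_zero_of_notMem_tsupport h2]
    · have h3 : deriv f p.1 = 0 :=
        image_eq_zero_of_notMem_tsupport fun h => h1 (tsupport_deriv_subset h)
      simp [hFdef, image_eq_zero_of_notMem_tsupport h1, h3]
  have hfd : ∀ x, HasDerivAt (fun x => (f x : ℂ)) ((deriv f x : ℝ) : ℂ) x := fun x =>
    (hf1.differentiable one_ne_zero x).hasDerivAt.ofReal_comp
  have hfd' : ∀ x, HasDerivAt (fun x => ((deriv f x : ℝ) : ℂ)) ((deriv (deriv f) x : ℝ) : ℂ) x := fun x =>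
    (hf'.differentiable one_ne_zero x).hasDerivAt.ofReal_comp
  have hχd : ∀ x, HasDerivAt (fun x => (χ x : ℂ)) ((deriv χ x : ℝ) : ℂ) x := fun x =>
    (hχ.differentiable one_ne_zero x).hasDerivAt.ofReal_comp
  have hFd := fun p => (hF.differentiable one_ne_zero p).hasFDerivAt
  have hσ : ∀ p : ℝ × ℝ, fderiv ℝ F p (1, 0) =
      (((deriv f p.1 : ℝ) : ℂ) + I * p.2 * ((deriv (deriv f) p.1 : ℝ) : ℂ)) * (χ p.2 : ℂ) := fun p =>
    ((hFd p).comp_hasDerivAt p.1 ((hasDerivAt_id p.1).prodMk (hasDerivAt_const p.1 p.2))).unique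
      (((hfd p.1).add ((hfd' p.1).const_mul (I * p.2))).mul_const (χ p.2 : ℂ))
  have hη : ∀ p : ℝ × ℝ, fderiv ℝ F p (0, 1) = I * ((deriv f p.1 : ℝ) : ℂ) * (χ p.2 : ℂ) +
      ((f p.1 : ℂ) + I * p.2 * ((deriv f p.1 : ℝ) : ℂ)) * ((deriv χ p.2 : ℝ) : ℂ) := by
    intro p
    refine ((hFd p).comp_hasDerivAt p.2
      ((hasDerivAt_const p.2 p.1).prodMk (hasDerivAt_id p.2))).unique ?_
    have h := (((((hasDerivAt_id p.2).ofReal_comp.const_mul I).mul_const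
      ((deriv f p.1 : ℝ) : ℂ)).const_add (f p.1 : ℂ)).mul (hχd p.2))
    exact h.congr_deriv (by simp)
  have hint := cauchy_pompeiu hF hFc (τ, 0)
  have hFτ : F (τ, 0) = f τ := by simp [hFdef, hχ0]
  rw [hFτ] at hint
  have hcongr : ∀ p : ℝ × ℝ,
      (I * (p.2 : ℂ) * ((deriv (deriv f) p.1 : ℝ) : ℂ) * (χ p.2 : ℂ) +
        I * ((f p.1 : ℂ) + I * (p.2 : ℂ) * ((deriv f p.1 : ℝ) : ℂ)) * ((deriv χ p.2 : ℝ) : ℂ)) /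
          ((τ : ℂ) - (p.1 : ℂ) - I * (p.2 : ℂ)) =
      (fderiv ℝ F p (1, 0) + I * fderiv ℝ F p (0, 1)) /
        ((τ - p.1) + I * ((0 : ℝ) - p.2)) := by
    intro p
    rw [hσ, hη]
    congr 1
    · linear_combination (-((deriv f p.1 : ℝ) : ℂ) * (χ p.2 : ℂ)) * I_sq
    · push_cast
      ring
  simp only [hcongr]
  rw [hint, show (2 * π * f τ : ℂ) = ((2 * π * f τ : ℝ) : ℂ) by push_cast; rfl, Complex.ofReal_re]
  field_simp
end
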